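/- With the notation of the finite normal-mode expansion, for every integer n ≥ 1: ∫_{−H}^0 B(u,v,w;u)(z)·U_n(z) dz = (1/√H)·(u_0·u^x_n + v_0·u^y_n + u_n·u^x_0 + v_n·u^y_0) + (1/√(2H))·[ Σ_{m=1}^{n−1} (u_{n−m}·u^x_m + v_{n−m}·u^y_m) + Σ_{m≥n+1} (u_{m−n}·u^x_m + v_{m−n}·u^y_m) + Σ_{m≥1} (u_{m+n}·u^x_m + v_{m+n}·u^y_m) ] − (1/√(2H))·[ Σ_{m≥n+1} λ_m·w_{m−n}·u_m + Σ_{m≥1} λ_m·w_{m+n}·u_m − Σ_{m=1}^{n−1} λ_m·w_{n−m}·u_m ] (all sums are finite since coefficients with index > M vanish). -/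

import Mathlib

/-- The eigenvalue `λ_n = nπ/H`. -/
noncomputable def lamC (H : ℝ) (n : ℕ) : ℝ := n * Real.pi / H

/-- The cosine normal-mode eigenfunctions: `U_0(z) = 1/√H`,
`U_n(z) = √(2/H)·cos(λ_n z)` for `n ≥ 1`. -/
noncomputable def Ue (H : ℝ) (n : ℕ) (z : ℝ) : ℝ :=
  if n = 0 then 1 / Real.sqrt H else Real.sqrt (2 / H) * Real.cos (lamC H n * z)

/-- The sine normal-mode eigenfunctions: `W_n(z) = √(2/H)·sin(λ_n z)`. -/
noncomputable def We (H : ℝ) (n : ℕ) (z : ℝ) : ℝ :=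
  Real.sqrt (2 / H) * Real.sin (lamC H n * z)

/-- Finite cosine-mode expansion `Σ_{m=0}^M U_m(z)·c_m`. -/
noncomputable def cosExp (H : ℝ) (M : ℕ) (c : ℕ → ℝ) (z : ℝ) : ℝ :=
  ∑ m ∈ Finset.range (M + 1), Ue H m z * c m

/-- Finite sine-mode expansion `Σ_{m=1}^M W_m(z)·c_m`. -/
noncomputable def sinExp (H : ℝ) (M : ℕ) (c : ℕ → ℝ) (z : ℝ) : ℝ :=
  ∑ m ∈ Finset.Icc 1 M, We H m z * c m

/-- `z`-derivative of the cosine-mode expansion: `−Σ_{m=1}^M λ_m W_m(z)·c_m`. -/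
noncomputable def dzCosExp (H : ℝ) (M : ℕ) (c : ℕ → ℝ) (z : ℝ) : ℝ :=
  -∑ m ∈ Finset.Icc 1 M, lamC H m * We H m z * c m

/-- `z`-derivative of the sine-mode expansion: `Σ_{m=1}^M λ_m U_m(z)·c_m`. -/
noncomputable def dzSinExp (H : ℝ) (M : ℕ) (c : ℕ → ℝ) (z : ℝ) : ℝ :=
  ∑ m ∈ Finset.Icc 1 M, lamC H m * Ue H m z * c m


lemma J_int (H : ℝ) (hH : 0 < H) (p : ℤ) :
    ∫ z in (-H)..0, Real.cos (p * Real.pi / H * z) = if p = 0 then H else 0 := by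
  split_ifs with h
  · subst h; simp
  · have hp : (p : ℝ) ≠ 0 := by exact_mod_cast h
    have hc : (p : ℝ) * Real.pi / H ≠ 0 := by
      have := Real.pi_ne_zero
      positivity
    rw [intervalIntegral.integral_comp_mul_left (fun x => Real.cos x) hc, integral_cos]
    have : (p : ℝ) * Real.pi / H * -H = -(p * Real.pi) := by field_simp
    rw [this]
    simp [Real.sin_int_mul_pi]

lemma J_ii (H : ℝ) (p : ℤ) :
    IntervalIntegrable (fun z => Real.cos (p * Real.pi / H * z)) MeasureTheory.volume (-H) 0 := by
  apply Continuous.intervalIntegrable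
  fun_prop

lemma ccc (H : ℝ) (hH : 0 < H) (a b n : ℕ) :
    ∫ z in (-H)..0, Real.cos (lamC H a * z) * Real.cos (lamC H b * z) * Real.cos (lamC H n * z)
      = (((if (a + b + n : ℤ) = 0 then H else 0) + (if (a + b - n : ℤ) = 0 then H else 0))
        + ((if (a - b + n : ℤ) = 0 then H else 0) + (if (a - b - n : ℤ) = 0 then H else 0))) / 4 := by
  rw [← J_int H hH, ← J_int H hH, ← J_int H hH, ← J_int H hH,
    ← intervalIntegral.integral_add (J_ii _ _) (J_ii _ _),
    ← intervalIntegral.integral_add (J_ii _ _) (J_ii _ _),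
    ← intervalIntegral.integral_add ((J_ii _ _).add (J_ii _ _)) ((J_ii _ _).add (J_ii _ _)),
    ← intervalIntegral.integral_div]
  refine intervalIntegral.integral_congr fun z _ => ?_
  beta_reduce
  have e : ∀ p : ℝ, p * Real.pi / H * z = p * (Real.pi / H * z) := fun p => by ring
  simp only [lamC, Int.cast_add, Int.cast_sub, Int.cast_natCast, e]
  simp only [add_mul, sub_mul]
  simp only [Real.cos_add, Real.cos_sub, Real.sin_add, Real.sin_sub]
  ring

lemma ssc (H : ℝ) (hH : 0 < H) (a b n : ℕ) :
    ∫ z in (-H)..0, Real.sin (lamC H a * z) * Real.sin (lamC H b * z) * Real.cos (lamC H n * z)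
      = (((if (a - b + n : ℤ) = 0 then H else 0) + (if (a - b - n : ℤ) = 0 then H else 0))
        - ((if (a + b + n : ℤ) = 0 then H else 0) + (if (a + b - n : ℤ) = 0 then H else 0))) / 4 := by
  rw [← J_int H hH, ← J_int H hH, ← J_int H hH, ← J_int H hH,
    ← intervalIntegral.integral_add (J_ii _ _) (J_ii _ _),
    ← intervalIntegral.integral_add (J_ii _ _) (J_ii _ _),
    ← intervalIntegral.integral_sub ((J_ii _ _).add (J_ii _ _)) ((J_ii _ _).add (J_ii _ _)),
    ← intervalIntegral.integral_div]
  refine intervalIntegral.integral_congr fun z _ => ?_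
  beta_reduce
  have e : ∀ p : ℝ, p * Real.pi / H * z = p * (Real.pi / H * z) := fun p => by ring
  simp only [lamC, Int.cast_add, Int.cast_sub, Int.cast_natCast, e]
  simp only [add_mul, sub_mul]
  simp only [Real.cos_add, Real.cos_sub, Real.sin_add, Real.sin_sub]
  ring

/-- Triple integral of cosine modes. -/
lemma UUU (H : ℝ) (hH : 0 < H) (a b n : ℕ) (hn : 1 ≤ n) :
    ∫ z in (-H)..0, Ue H a z * Ue H b z * Ue H n z
      = if b = 0 then (if a = n then 1 / √H else 0)
        else if a = 0 then (if b = n then 1 / √H else 0)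
        else 1 / √(2 * H) * ((if a + b = n then 1 else 0) + (if a + n = b then 1 else 0)
          + (if a = b + n then 1 else 0)) := by
  have e : ∀ m z, Ue H m z = (if m = 0 then 1 / √H else √(2 / H)) * Real.cos (lamC H m * z) := by
    intro m z
    unfold Ue
    split_ifs with h
    · simp [h, lamC]
    · rfl
  have e2 : ∀ z, Ue H a z * Ue H b z * Ue H n z =
    ((if a = 0 then 1 / √H else √(2 / H)) * (if b = 0 then 1 / √H else √(2 / H)) * √(2 / H)) *
     (Real.cos (lamC H a * z) * Real.cos (lamC H b * z) * Real.cos (lamC H n * z)) := by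
    intro z
    rw [e, e, e, if_neg (show n ≠ 0 by omega)]
    ring
  simp only [e2]
  rw [intervalIntegral.integral_const_mul, ccc H hH]
  have i1 : ((a + b + n : ℤ) = 0) ↔ False := by constructor <;> intros <;> [omega; tauto]
  have i2 : ((a + b - n : ℤ) = 0) ↔ a + b = n := by omega
  have i3 : ((a - b + n : ℤ) = 0) ↔ a + n = b := by omega
  have i4 : ((a - b - n : ℤ) = 0) ↔ a = b + n := by omega
  simp only [i1, i2, i3, i4, if_false]
  have h2 : √2 ^ 2 = 2 := Real.sq_sqrt (by norm_num)
  have hs : √H ^ 2 = H := Real.sq_sqrt hH.le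
  have hs0 : 0 < √H := Real.sqrt_pos.mpr hH
  have h20 : 0 < √(2:ℝ) := Real.sqrt_pos.mpr (by norm_num)
  rw [Real.sqrt_div (by norm_num), Real.sqrt_mul (by norm_num)]
  generalize √H = s at *
  generalize √(2:ℝ) = t at *
  subst hs
  have h4 : t ^ 4 = 4 := by rw [show t ^ 4 = (t ^ 2) ^ 2 by ring, h2]; norm_num
  split_ifs <;> first | omega | (simp; done) | (field_simp; (try simp only [h2, h4]); (try ring_nf); (try simp only [h2, h4]); (try norm_num))

/-- Triple integral of two sine modes and a cosine mode. -/
lemma WWU (H : ℝ) (hH : 0 < H) (a b n : ℕ) (hn : 1 ≤ n) :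
    ∫ z in (-H)..0, We H a z * We H b z * Ue H n z
      = 1 / √(2 * H) * ((if a + n = b then 1 else 0) + (if a = b + n then 1 else 0)
          - (if a + b = n then 1 else 0)) := by
  have e2 : ∀ z, We H a z * We H b z * Ue H n z =
    (√(2 / H) * √(2 / H) * √(2 / H)) *
     (Real.sin (lamC H a * z) * Real.sin (lamC H b * z) * Real.cos (lamC H n * z)) := by
    intro z
    unfold We Ue
    rw [if_neg (show n ≠ 0 by omega)]
    ring
  simp only [e2]
  rw [intervalIntegral.integral_const_mul, ssc H hH]
  have i1 : ((a + b + n : ℤ) = 0) ↔ False := by constructor <;> intros <;> [omega; tauto]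
  have i2 : ((a + b - n : ℤ) = 0) ↔ a + b = n := by omega
  have i3 : ((a - b + n : ℤ) = 0) ↔ a + n = b := by omega
  have i4 : ((a - b - n : ℤ) = 0) ↔ a = b + n := by omega
  simp only [i1, i2, i3, i4, if_false]
  have h2 : √2 ^ 2 = 2 := Real.sq_sqrt (by norm_num)
  have hs : √H ^ 2 = H := Real.sq_sqrt hH.le
  have hs0 : 0 < √H := Real.sqrt_pos.mpr hH
  have h20 : 0 < √(2:ℝ) := Real.sqrt_pos.mpr (by norm_num)
  rw [Real.sqrt_div (by norm_num), Real.sqrt_mul (by norm_num)]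
  generalize √H = s at *
  generalize √(2:ℝ) = t at *
  subst hs
  have h4 : t ^ 4 = 4 := by rw [show t ^ 4 = (t ^ 2) ^ 2 by ring, h2]; norm_num
  split_ifs <;> first | omega | (simp; done) | (field_simp; (try simp only [h2, h4]); (try ring_nf); (try simp only [h2, h4]); (try norm_num))

lemma Ue_cont (H : ℝ) (n : ℕ) : Continuous (Ue H n) := by
  unfold Ue
  split_ifs <;> fun_prop

lemma We_cont (H : ℝ) (n : ℕ) : Continuous (We H n) := by
  unfold We
  fun_prop

lemma triple_sum (H : ℝ) (M : ℕ) (F G : ℕ → ℝ → ℝ) (K : ℝ → ℝ) (hF : ∀ m, Continuous (F m))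
    (hG : ∀ m, Continuous (G m)) (hK : Continuous K) (c d : ℕ → ℝ) :
    ∫ z in (-H)..0, (∑ a ∈ Finset.range (M + 1), F a z * c a) *
        (∑ b ∈ Finset.range (M + 1), G b z * d b) * K z
      = ∑ b ∈ Finset.range (M + 1), d b * ∑ a ∈ Finset.range (M + 1), c a *
          ∫ z in (-H)..0, F a z * G b z * K z := by
  have : ∀ z, (∑ a ∈ Finset.range (M + 1), F a z * c a) *
        (∑ b ∈ Finset.range (M + 1), G b z * d b) * K z
      = ∑ b ∈ Finset.range (M + 1), ∑ a ∈ Finset.range (M + 1),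
          d b * (c a * (F a z * G b z * K z)) := by
    intro z
    rw [Finset.sum_mul_sum, Finset.sum_comm, Finset.sum_mul]
    refine Finset.sum_congr rfl fun b _ => ?_
    rw [Finset.sum_mul]
    refine Finset.sum_congr rfl fun a _ => ?_
    ring
  simp only [this]
  rw [intervalIntegral.integral_finsetSum]
  · refine Finset.sum_congr rfl fun b _ => ?_
    rw [intervalIntegral.integral_finsetSum, Finset.mul_sum]
    · refine Finset.sum_congr rfl fun a _ => ?_
      rw [intervalIntegral.integral_const_mul, intervalIntegral.integral_const_mul]
    · intro a _
      apply Continuous.intervalIntegrable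
      fun_prop
  · intro b _
    apply Continuous.intervalIntegrable
    fun_prop

lemma pick (M : ℕ) (c : ℕ → ℝ) (hc : ∀ m, M < m → c m = 0) (k : ℕ) :
    ∑ a ∈ Finset.range (M + 1), c a * (if a = k then 1 else 0) = c k := by
  simp only [mul_ite, mul_one, mul_zero, Finset.sum_ite_eq', Finset.mem_range]
  split_ifs with h
  · rfl
  · rw [hc k (by omega)]

lemma pick2 (M : ℕ) (c : ℕ → ℝ) (hc : ∀ m, M < m → c m = 0) (b n : ℕ) :
    ∑ a ∈ Finset.range (M + 1), c a * (if a + b = n then 1 else 0)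
      = if b ≤ n then c (n - b) else 0 := by
  split_ifs with h
  · rw [← pick M c hc]
    refine Finset.sum_congr rfl fun a _ => ?_
    congr 2
    simp only [eq_iff_iff]
    omega
  · refine Finset.sum_eq_zero fun a _ => ?_
    rw [if_neg (by omega), mul_zero]

lemma innerU (H : ℝ) (hH : 0 < H) (M : ℕ) (c : ℕ → ℝ) (hc : ∀ m, M < m → c m = 0)
    (b n : ℕ) (hn : 1 ≤ n) :
    ∑ a ∈ Finset.range (M + 1), c a * ∫ z in (-H)..0, Ue H a z * Ue H b z * Ue H n z
      = (if b = 0 then 1 / √H * c n else 0) + (if b = n then 1 / √H * c 0 else 0)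
        + 1 / √(2 * H) * ((if 1 ≤ b ∧ b < n then c (n - b) else 0)
          + (if n + 1 ≤ b then c (b - n) else 0) + (if 1 ≤ b then c (b + n) else 0)) := by
  have key : ∀ a, c a * ∫ z in (-H)..0, Ue H a z * Ue H b z * Ue H n z
      = (if b = 0 then 1 / √H else 0) * (c a * (if a = n then 1 else 0))
        + (if b = n then 1 / √H else 0) * (c a * (if a = 0 then 1 else 0))
        + 1 / √(2 * H) * ((if 1 ≤ b ∧ b < n then 1 else 0) * (c a * (if a + b = n then 1 else 0))
          + (if n + 1 ≤ b then 1 else 0) * (c a * (if a + n = b then 1 else 0))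
          + (if 1 ≤ b then 1 else 0) * (c a * (if a = b + n then 1 else 0))) := by
    intro a
    rw [UUU H hH a b n hn]
    split_ifs <;> first | omega | (simp; done) | (ring; done)
  simp only [key, Finset.sum_add_distrib, ← Finset.mul_sum, pick M c hc, pick2 M c hc]
  split_ifs <;> first | omega | (simp; done) | (ring; done)

lemma innerW (H : ℝ) (hH : 0 < H) (M : ℕ) (c : ℕ → ℝ) (hc : ∀ m, M < m → c m = 0)
    (b n : ℕ) (hn : 1 ≤ n) (hb : 1 ≤ b) :
    ∑ a ∈ Finset.range (M + 1), c a * ∫ z in (-H)..0, We H a z * We H b z * Ue H n z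
      = 1 / √(2 * H) * ((if n + 1 ≤ b then c (b - n) else 0) + (if 1 ≤ b then c (b + n) else 0)
          - (if 1 ≤ b ∧ b < n then c (n - b) else 0)) := by
  have key : ∀ a, c a * ∫ z in (-H)..0, We H a z * We H b z * Ue H n z
      = 1 / √(2 * H) * (c a * (if a + n = b then 1 else 0) + (c a * (if a = b + n then 1 else 0))
          - (c a * (if a + b = n then 1 else 0))) := by
    intro a
    rw [WWU H hH a b n hn]
    ring
  simp only [key, Finset.sum_add_distrib, Finset.sum_sub_distrib, ← Finset.mul_sum,
    pick M c hc, pick2 M c hc]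
  congr 1
  rcases lt_trichotomy b n with h | h | h
  · simp [show ¬ n ≤ b by omega, show ¬ n + 1 ≤ b by omega, h, h.le, hb]
  · subst h; simp [hb]
  · simp [show ¬ b ≤ n by omega, show n + 1 ≤ b by omega, h.le, hb, show ¬ b < n by omega]

lemma sum_Ico_ite (M n : ℕ) (f : ℕ → ℝ) (hf : ∀ m, M < m → f m = 0) :
    ∑ m ∈ Finset.Ico 1 n, f m
      = ∑ m ∈ Finset.range (M + 1), if 1 ≤ m ∧ m < n then f m else 0 := by
  rw [← Finset.sum_filter]
  symm
  apply Finset.sum_subset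
  · intro m; simp
  · intro m h1 h2
    apply hf
    simp at h1 h2
    by_contra h
    have := h2 (by omega) h1.1
    omega

lemma tsum_ite (M : ℕ) (P : ℕ → Prop) [DecidablePred P] (f : ℕ → ℝ)
    (hf : ∀ m, M < m → f m = 0) :
    (∑' m : ℕ, if P m then f m else 0)
      = ∑ m ∈ Finset.range (M + 1), if P m then f m else 0 := by
  apply tsum_eq_sum
  intro m hm
  simp at hm
  rw [hf m (by omega), ite_self]

lemma sum_Icc_range (M : ℕ) (f : ℕ → ℝ) (hf : f 0 = 0) :
    ∑ m ∈ Finset.Icc 1 M, f m = ∑ m ∈ Finset.range (M + 1), f m := by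
  apply Finset.sum_subset
  · intro m; simp
  · intro m h1 h2
    simp at h1 h2
    have : m = 0 := by by_contra h; have := h2 (by omega); omega
    rw [this, hf]

lemma cosCos (H : ℝ) (hH : 0 < H) (M : ℕ) (c d : ℕ → ℝ) (hc : ∀ m, M < m → c m = 0)
    (hd : ∀ m, M < m → d m = 0) (n : ℕ) (hn : 1 ≤ n) :
    ∫ z in (-H)..0, cosExp H M c z * cosExp H M d z * Ue H n z
      = 1 / √H * (c 0 * d n + c n * d 0) + 1 / √(2 * H) *
        ((∑ m ∈ Finset.range (M + 1), if 1 ≤ m ∧ m < n then c (n - m) * d m else 0)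
        + (∑ m ∈ Finset.range (M + 1), if n + 1 ≤ m then c (m - n) * d m else 0)
        + (∑ m ∈ Finset.range (M + 1), if 1 ≤ m then c (m + n) * d m else 0)) := by
  unfold cosExp
  rw [triple_sum H M _ _ _ (Ue_cont H) (Ue_cont H) (Ue_cont H n)]
  simp only [innerU H hH M c hc _ n hn]
  rw [← pick M d hd n, ← pick M d hd 0]
  simp only [Finset.mul_sum, mul_add, ← Finset.sum_add_distrib]
  refine Finset.sum_congr rfl fun b _ => ?_
  split_ifs <;> first | omega | (simp; done) | (ring; done)

lemma sinSin (H : ℝ) (hH : 0 < H) (M : ℕ) (c d : ℕ → ℝ) (hc : ∀ m, M < m → c m = 0)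
    (n : ℕ) (hn : 1 ≤ n) :
    ∫ z in (-H)..0, sinExp H M c z * dzCosExp H M d z * Ue H n z
      = - (1 / √(2 * H) *
        ((∑ m ∈ Finset.range (M + 1), if n + 1 ≤ m then lamC H m * c (m - n) * d m else 0)
        + (∑ m ∈ Finset.range (M + 1), if 1 ≤ m then lamC H m * c (m + n) * d m else 0)
        - (∑ m ∈ Finset.range (M + 1),
            if 1 ≤ m ∧ m < n then lamC H m * c (n - m) * d m else 0))) := by
  have e : ∀ z, sinExp H M c z * dzCosExp H M d z * Ue H n z =
      - ((∑ a ∈ Finset.range (M + 1), We H a z * c a) *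
        (∑ b ∈ Finset.range (M + 1), We H b z * (lamC H b * d b)) * Ue H n z) := by
    intro z
    unfold sinExp dzCosExp
    rw [sum_Icc_range _ _ (by simp [We, lamC]), sum_Icc_range _ _ (by simp [We, lamC])]
    have : ∀ m, lamC H m * We H m z * d m = We H m z * (lamC H m * d m) := fun m => by ring
    simp only [this]
    ring
  simp only [e]
  rw [intervalIntegral.integral_neg,
    triple_sum H M _ _ _ (We_cont H) (We_cont H) (Ue_cont H n)]
  congr 1
  simp only [← Finset.sum_add_distrib, ← Finset.sum_sub_distrib, Finset.mul_sum (a := 1 / √(2 * H))]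
  refine Finset.sum_congr rfl fun b _ => ?_
  rcases Nat.eq_zero_or_pos b with h | h
  · subst h; simp [lamC]
  · rw [innerW H hH M c hc b n hn h]
    split_ifs <;> first | omega | (simp; done) | (ring; done)

/-- Projection of the nonlinear term `B(u,v,w;u) = u·u_x + v·u_y + w·u_z` onto the
baroclinic mode `U_n`, `n ≥ 1`.  Here `uc, vc, ucx, ucy, wc` are the normal-mode
coefficients (at a fixed point) of `u, v, ∂u/∂x, ∂u/∂y, w`, all vanishing above `M`. -/
theorem B_u_proj_n (H : ℝ) (hH : 0 < H) (M : ℕ) (hM : 1 ≤ M)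
    (uc vc ucx ucy wc : ℕ → ℝ)
    (huc : ∀ m, M < m → uc m = 0) (hvc : ∀ m, M < m → vc m = 0)
    (hucx : ∀ m, M < m → ucx m = 0) (hucy : ∀ m, M < m → ucy m = 0)
    (hwc : ∀ m, M < m → wc m = 0)
    (n : ℕ) (hn : 1 ≤ n) :
    (∫ z in (-H)..0,
        (cosExp H M uc z * cosExp H M ucx z + cosExp H M vc z * cosExp H M ucy z +
          sinExp H M wc z * dzCosExp H M uc z) * Ue H n z)
      = (1 / Real.sqrt H) *
          (uc 0 * ucx n + vc 0 * ucy n + uc n * ucx 0 + vc n * ucy 0)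
        + (1 / Real.sqrt (2 * H)) *
          ((∑ m ∈ Finset.Ico 1 n, (uc (n - m) * ucx m + vc (n - m) * ucy m))
            + (∑' m : ℕ, if n + 1 ≤ m then uc (m - n) * ucx m + vc (m - n) * ucy m else 0)
            + (∑' m : ℕ, if 1 ≤ m then uc (m + n) * ucx m + vc (m + n) * ucy m else 0))
        - (1 / Real.sqrt (2 * H)) *
          ((∑' m : ℕ, if n + 1 ≤ m then lamC H m * wc (m - n) * uc m else 0)
            + (∑' m : ℕ, if 1 ≤ m then lamC H m * wc (m + n) * uc m else 0)
            - (∑ m ∈ Finset.Ico 1 n, lamC H m * wc (n - m) * uc m)) := by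
  have c1 : ∀ c, Continuous (cosExp H M c) := fun c => by
    have := Ue_cont H
    unfold cosExp; fun_prop
  have c2 : ∀ c, Continuous (sinExp H M c) := fun c => by
    have := We_cont H
    unfold sinExp; fun_prop
  have c3 : ∀ c, Continuous (dzCosExp H M c) := fun c => by
    have := We_cont H
    unfold dzCosExp; fun_prop
  have c4 := Ue_cont H n
  simp only [add_mul]
  rw [intervalIntegral.integral_add, intervalIntegral.integral_add,
    cosCos H hH M uc ucx huc hucx n hn, cosCos H hH M vc ucy hvc hucy n hn,
    sinSin H hH M wc uc hwc n hn,
    sum_Ico_ite M n _ (fun m hm => by simp [hucx m hm, hucy m hm]),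
    sum_Ico_ite M n _ (fun m hm => by simp [huc m hm]),
    tsum_ite M _ _ (fun m hm => by simp [hucx m hm, hucy m hm]),
    tsum_ite M _ _ (fun m hm => by simp [hucx m hm, hucy m hm]),
    tsum_ite M _ _ (fun m hm => by simp [huc m hm]),
    tsum_ite M _ _ (fun m hm => by simp [huc m hm])]
  · have sp : ∀ (P : ℕ → Prop) [DecidablePred P] (f g : ℕ → ℝ),
        (∑ m ∈ Finset.range (M + 1), if P m then f m + g m else 0)
        = (∑ m ∈ Finset.range (M + 1), if P m then f m else 0)
          + ∑ m ∈ Finset.range (M + 1), if P m then g m else 0 := by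
      intro P _ f g
      rw [← Finset.sum_add_distrib]
      refine Finset.sum_congr rfl fun b _ => ?_
      split_ifs <;> simp
    rw [sp, sp, sp]
    ring
  all_goals
    apply Continuous.intervalIntegrable
    have := c1 uc
    have := c1 vc
    have := c1 ucx
    have := c1 ucy
    have := c2 wc
    have := c3 uc
    fun_prop
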